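/- arXiv:1902.02208 — 3 statements merged into one kernel-verified Lean document; each statement's English description precedes it below -/
import Mathlib

section
/- Let I be a nonempty finite index set, x : I → ℝ^d a family of data points, and c : I → Fin C a class assignment such that every class k is nonempty; let μ_k denote the mean of the points x_i with c(i) = k, n_k the size of class k, μ the mean of all points, and S_b = Σ_{k} n_k (μ_k − μ)(μ_k − μ)ᵀ the between-class scatter matrix. Then the rank of S_b is at most C − 1. -/
open Matrix

/-- A weighted sum of rank-one matrices `v k (u k)ᵀ` whose weighted left factors sum to zero has
rank less than the number of summands, provided some weight is nonzero. -/
theorem rank_sum_smul_vecMulVec_le {K ι m n : Type*} [Field K] [Fintype ι] [DecidableEq ι]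
    [Fintype m] [Fintype n] (w : ι → K) (v : ι → m → K) (u : ι → n → K)
    (hsum : ∑ k, w k • v k = 0) {k₀ : ι} (hk₀ : w k₀ ≠ 0) :
    (∑ k, w k • vecMulVec (v k) (u k)).rank ≤ Fintype.card ι - 1 := by
  classical
  set s : Finset (m → K) := (Finset.univ.erase k₀).image v
  have hmem : ∀ k, v k ∈ Submodule.span K (s : Set (m → K)) := by
    have hne : ∀ k, k ≠ k₀ → v k ∈ Submodule.span K (s : Set (m → K)) := fun k hk =>
      Submodule.subset_span (Finset.mem_coe.2 (Finset.mem_image_of_mem v (by simp [hk])))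
    intro k
    by_cases hk : k = k₀
    · rw [hk, ← Submodule.smul_mem_iff _ hk₀]
      rw [← Finset.add_sum_erase _ _ (Finset.mem_univ k₀)] at hsum
      rw [eq_neg_of_add_eq_zero_left hsum]
      exact Submodule.neg_mem _ (Submodule.sum_mem _ fun j hj =>
        Submodule.smul_mem _ _ (hne j (Finset.ne_of_mem_erase hj)))
    · exact hne k hk
  have hrange : LinearMap.range (∑ k, w k • vecMulVec (v k) (u k)).mulVecLin ≤
      Submodule.span K (s : Set (m → K)) := by
    rintro _ ⟨y, rfl⟩
    rw [mulVecLin_apply, sum_mulVec]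
    refine Submodule.sum_mem _ fun k _ => ?_
    rw [smul_mulVec, vecMulVec_mulVec, op_smul_eq_smul]
    exact Submodule.smul_mem _ _ (Submodule.smul_mem _ _ (hmem k))
  calc (∑ k, w k • vecMulVec (v k) (u k)).rank
      ≤ Module.finrank K (Submodule.span K (s : Set (m → K))) := Submodule.finrank_mono hrange
    _ ≤ s.card := finrank_span_finset_le_card s
    _ ≤ (Finset.univ.erase k₀).card := Finset.card_image_le
    _ = Fintype.card ι - 1 := by
      rw [Finset.card_erase_of_mem (Finset.mem_univ k₀), Finset.card_univ]

/-- For a finite nonempty family of data points `x : I → ℝ^d` with class assignment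
`c : I → Fin C` (each class nonempty), class means `μ_k`, class sizes `n_k`, global mean `μ`
and between-class scatter matrix `S_b = Σ_k n_k (μ_k − μ)(μ_k − μ)ᵀ`, the rank of `S_b` is at
most `C − 1`. -/
theorem stmt8 (I : Type*) [Fintype I] [Nonempty I] (d C : ℕ)
    (x : I → Fin d → ℝ) (c : I → Fin C)
    (hclass : ∀ k : Fin C, ∃ i : I, c i = k)
    (μcls : Fin C → Fin d → ℝ)
    (hμcls : ∀ k : Fin C,
      μcls k = ((Finset.univ.filter (fun i : I => c i = k)).card : ℝ)⁻¹ •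
                 ∑ i ∈ Finset.univ.filter (fun i : I => c i = k), x i)
    (μ : Fin d → ℝ)
    (hμ : μ = ((Fintype.card I : ℝ))⁻¹ • ∑ i : I, x i)
    (Sb : Matrix (Fin d) (Fin d) ℝ)
    (hSb : Sb = ∑ k : Fin C,
      ((Finset.univ.filter (fun i : I => c i = k)).card : ℝ) •
        vecMulVec (μcls k - μ) (μcls k - μ)) :
    Sb.rank ≤ C - 1 := by
  have hcard : ∀ k : Fin C, ((Finset.univ.filter (fun i : I => c i = k)).card : ℝ) ≠ 0 := by
    intro k
    obtain ⟨i, hi⟩ := hclass k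
    exact Nat.cast_ne_zero.2 (Finset.card_ne_zero_of_mem (Finset.mem_filter.2
      ⟨Finset.mem_univ i, hi⟩))
  have hsum : ∑ k : Fin C, ((Finset.univ.filter (fun i : I => c i = k)).card : ℝ) •
      (μcls k - μ) = 0 := by
    have hcls : ∑ k : Fin C, ((Finset.univ.filter (fun i : I => c i = k)).card : ℝ) • μcls k =
        ∑ i : I, x i := by
      simp_rw [hμcls, smul_inv_smul₀ (hcard _)]
      exact Finset.sum_fiberwise _ _ _
    have htotal : ∑ k : Fin C, ((Finset.univ.filter (fun i : I => c i = k)).card : ℝ) =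
        Fintype.card I := by
      exact_mod_cast (Finset.card_eq_sum_card_fiberwise (f := c) (s := Finset.univ)
        (t := Finset.univ) (fun _ _ => Finset.mem_coe.2 (Finset.mem_univ _))).symm
    simp_rw [smul_sub]
    rw [Finset.sum_sub_distrib, hcls, ← Finset.sum_smul, htotal, hμ,
      smul_inv_smul₀ (Nat.cast_ne_zero.2 Fintype.card_ne_zero), sub_self]
  obtain ⟨i₀⟩ := ‹Nonempty I›
  rw [hSb]
  simpa using rank_sum_smul_vecMulVec_le _ _ (fun k => μcls k - μ) hsum (hcard (c i₀))
end

section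
/- Let x₁, …, xₙ be pairwise distinct points in ℝ^d and γ > 0. Then the Gaussian (RBF) kernel matrix K defined by K_{ij} = exp(−γ ‖xᵢ − xⱼ‖²) is symmetric positive definite: K is symmetric and vᵀKv > 0 for every nonzero v ∈ ℝⁿ. -/
open Matrix

section GaussianKernel

open MeasureTheory

variable {E : Type*} [NormedAddCommGroup E] [InnerProductSpace ℝ E]

/-- Distinct exponential functions `t ↦ exp (c ⟪a, t⟫)` are linearly independent. -/
lemma linearIndependent_exp_inner {ι : Type*} {x : ι → E} (hx : Function.Injective x)
    {c : ℝ} (hc : c ≠ 0) :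
    LinearIndependent ℝ (fun i (t : E) => Real.exp (c * inner ℝ (x i) t)) := by
  let χ : ι → (Multiplicative E →* ℝ) := fun i =>
    { toFun := fun t => Real.exp (c * inner ℝ (x i) t.toAdd)
      map_one' := by simp
      map_mul' := fun s t => by simp [inner_add_right, mul_add, Real.exp_add] }
  have hχ : Function.Injective χ := fun i j hij => hx <| ext_inner_right ℝ fun t => by
    have h := DFunLike.congr_fun hij (Multiplicative.ofAdd t)
    simpa [χ, hc] using h
  exact (linearIndependent_monoidHom (Multiplicative E) ℝ).comp χ hχ

/-- Distinct translates of a Gaussian function are linearly independent. -/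
lemma linearIndependent_gaussian_translates {ι : Type*} {x : ι → E}
    (hx : Function.Injective x) {b : ℝ} (hb : b ≠ 0) :
    LinearIndependent ℝ (fun i (t : E) => Real.exp (-b * ‖t - x i‖ ^ 2)) := by
  have key (i : ι) (t : E) : Real.exp (-b * ‖t - x i‖ ^ 2) =
      Real.exp (-b * ‖t‖ ^ 2) *
        (Real.exp (-b * ‖x i‖ ^ 2) * Real.exp (2 * b * inner ℝ (x i) t)) := by
    rw [← Real.exp_add, ← Real.exp_add, norm_sub_sq_real, real_inner_comm]
    ring_nf
  rw [linearIndependent_iff']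
  intro s v hv i hi
  have h := linearIndependent_iff'.1 (linearIndependent_exp_inner hx (mul_ne_zero two_ne_zero hb))
    s (fun i => v i * Real.exp (-b * ‖x i‖ ^ 2)) ?_ i hi
  · simpa using h
  · ext t
    have ht := congrFun hv t
    simp only [Finset.sum_apply, Pi.smul_apply, smul_eq_mul, Pi.zero_apply, key] at ht ⊢
    refine (mul_eq_zero.1 ?_).resolve_left (Real.exp_ne_zero (-b * ‖t‖ ^ 2))
    rw [← ht, Finset.mul_sum]
    exact Finset.sum_congr rfl fun _ _ => by ring

lemma gaussian_mul_gaussian (b : ℝ) (x y t : E) :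
    Real.exp (-(2 * b) * ‖t - x‖ ^ 2) * Real.exp (-(2 * b) * ‖t - y‖ ^ 2) =
      Real.exp (-(4 * b) * ‖t - (2⁻¹ : ℝ) • (x + y)‖ ^ 2) * Real.exp (-b * ‖x - y‖ ^ 2) := by
  rw [← Real.exp_add, ← Real.exp_add]
  congr 1
  simp only [norm_sub_sq_real, norm_smul, mul_pow, norm_add_sq_real, inner_smul_right,
    inner_add_right]
  norm_num
  ring

variable [FiniteDimensional ℝ E] [MeasurableSpace E] [BorelSpace E]

lemma integral_gaussian_pos {b : ℝ} (hb : 0 < b) : 0 < ∫ t : E, Real.exp (-b * ‖t‖ ^ 2) := by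
  rw [GaussianFourier.integral_rexp_neg_mul_sq_norm hb]
  positivity

lemma integrable_gaussian {b : ℝ} (hb : 0 < b) :
    Integrable (fun t : E => Real.exp (-b * ‖t‖ ^ 2)) :=
  not_imp_comm.1 integral_undef (integral_gaussian_pos hb).ne'

lemma integrable_gaussian_mul_gaussian {b : ℝ} (hb : 0 < b) (x y : E) :
    Integrable (fun t : E =>
      Real.exp (-(2 * b) * ‖t - x‖ ^ 2) * Real.exp (-(2 * b) * ‖t - y‖ ^ 2)) := by
  simp only [gaussian_mul_gaussian]
  exact ((integrable_gaussian (by positivity : 0 < 4 * b)).comp_sub_right _).mul_const _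

lemma integral_gaussian_mul_gaussian (b : ℝ) (x y : E) :
    ∫ t : E, Real.exp (-(2 * b) * ‖t - x‖ ^ 2) * Real.exp (-(2 * b) * ‖t - y‖ ^ 2) =
      (∫ t : E, Real.exp (-(4 * b) * ‖t‖ ^ 2)) * Real.exp (-b * ‖x - y‖ ^ 2) := by
  simp only [gaussian_mul_gaussian]
  rw [integral_mul_const,
    integral_sub_right_eq_self (fun t : E => Real.exp (-(4 * b) * ‖t‖ ^ 2))]

/-- The quadratic form of the Gaussian kernel at distinct points is positive. -/
lemma gaussian_kernel_sum_pos {ι : Type*} [Fintype ι] {x : ι → E} (hx : Function.Injective x)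
    {b : ℝ} (hb : 0 < b) {v : ι → ℝ} (hv : v ≠ 0) :
    0 < ∑ i, ∑ j, v i * v j * Real.exp (-b * ‖x i - x j‖ ^ 2) := by
  let f : E → ℝ := fun t => ∑ i, v i * Real.exp (-(2 * b) * ‖t - x i‖ ^ 2)
  have hsq (t : E) : f t ^ 2 = ∑ i, ∑ j, v i * v j *
      (Real.exp (-(2 * b) * ‖t - x i‖ ^ 2) * Real.exp (-(2 * b) * ‖t - x j‖ ^ 2)) := by
    rw [sq, Finset.sum_mul_sum]
    exact Finset.sum_congr rfl fun _ _ => Finset.sum_congr rfl fun _ _ => by ring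
  have hint (i j : ι) : Integrable (fun t : E => v i * v j *
      (Real.exp (-(2 * b) * ‖t - x i‖ ^ 2) * Real.exp (-(2 * b) * ‖t - x j‖ ^ 2))) :=
    (integrable_gaussian_mul_gaussian hb _ _).const_mul _
  have hf_int : Integrable (fun t => f t ^ 2) := by
    simp only [hsq]
    exact integrable_finsetSum _ fun i _ => integrable_finsetSum _ fun j _ => hint i j
  have hf_ne : ∃ t, f t ≠ 0 := by
    by_contra! h
    refine hv (funext fun i => ?_)
    refine linearIndependent_iff'.1 (linearIndependent_gaussian_translates hx
      (mul_pos two_pos hb).ne') Finset.univ v ?_ i (Finset.mem_univ i)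
    ext t
    simpa [f] using h t
  obtain ⟨t, ht⟩ := hf_ne
  have hpos : 0 < ∫ t, f t ^ 2 :=
    integral_pos_of_integrable_nonneg_nonzero (x := t) (by fun_prop) hf_int
      (fun t => sq_nonneg (f t)) (pow_ne_zero 2 ht)
  have heq : ∫ t, f t ^ 2 = (∫ t : E, Real.exp (-(4 * b) * ‖t‖ ^ 2)) *
      ∑ i, ∑ j, v i * v j * Real.exp (-b * ‖x i - x j‖ ^ 2) := by
    simp only [hsq]
    rw [integral_finsetSum _ fun i _ => integrable_finsetSum _ fun j _ => hint i j,
      Finset.mul_sum]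
    refine Finset.sum_congr rfl fun i _ => ?_
    rw [integral_finsetSum _ fun j _ => hint i j, Finset.mul_sum]
    refine Finset.sum_congr rfl fun j _ => ?_
    rw [integral_const_mul, integral_gaussian_mul_gaussian]
    ring
  rw [heq] at hpos
  exact pos_of_mul_pos_right hpos (integral_gaussian_pos (by positivity)).le

end GaussianKernel

/-- For pairwise distinct points `x₁, …, xₙ ∈ ℝ^d` and `γ > 0`, the Gaussian (RBF) kernel
matrix `K` with `K_{ij} = exp(−γ ‖xᵢ − xⱼ‖²)` is symmetric positive definite: `K` is symmetric
and `vᵀKv > 0` for every nonzero `v ∈ ℝⁿ`. -/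
theorem stmt9 (n d : ℕ) (x : Fin n → EuclideanSpace ℝ (Fin d))
    (hx : Function.Injective x) (γ : ℝ) (hγ : 0 < γ)
    (K : Matrix (Fin n) (Fin n) ℝ)
    (hK : ∀ i j : Fin n, K i j = Real.exp (-γ * ‖x i - x j‖ ^ 2)) :
    K.IsSymm ∧ ∀ v : Fin n → ℝ, v ≠ 0 → 0 < v ⬝ᵥ K.mulVec v := by
  refine ⟨Matrix.IsSymm.ext fun i j => by rw [hK, hK, norm_sub_rev], fun v hv => ?_⟩
  convert gaussian_kernel_sum_pos hx hγ hv using 1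
  simp only [dotProduct, mulVec, Finset.mul_sum, hK]
  exact Finset.sum_congr rfl fun _ _ => Finset.sum_congr rfl fun _ _ => by ring
end

section
/- Let S_w and S_b be symmetric real d×d matrices with S_w positive semidefinite. Suppose there exists φ₀ ∈ ℝ^d with φ₀ᵀ S_w φ₀ = 0 and φ₀ᵀ S_b φ₀ > 0 (a null projection direction), and there exists ψ ∈ ℝ^d with ψᵀ S_w ψ > 0. Then the Fisher criterion J(φ) = (φᵀ S_b φ)/(φᵀ S_w φ) is unbounded above on the set {φ ∈ ℝ^d : φᵀ S_w φ > 0}: for every M ∈ ℝ there exists φ with φᵀ S_w φ > 0 and (φᵀ S_b φ)/(φᵀ S_w φ) > M. -/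
open Matrix

/-- The quadratic form of a matrix along a line is a polynomial of degree two in the parameter. -/
theorem dotProduct_mulVec_add_smul {n R : Type*} [Fintype n] [CommRing R]
    (A : Matrix n n R) (u v : n → R) (t : R) :
    (u + t • v) ⬝ᵥ A.mulVec (u + t • v) =
      u ⬝ᵥ A.mulVec u + t * (u ⬝ᵥ A.mulVec v + v ⬝ᵥ A.mulVec u) + t ^ 2 * (v ⬝ᵥ A.mulVec v) := by
  simp only [mulVec_add, mulVec_smul, dotProduct_add, add_dotProduct, smul_dotProduct,
    dotProduct_smul, smul_eq_mul]
  ring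

/-- For symmetric real `d×d` matrices `S_w` (positive semidefinite) and `S_b`, if there is a
null projection direction `φ₀` (with `φ₀ᵀ S_w φ₀ = 0` and `φ₀ᵀ S_b φ₀ > 0`) and some `ψ` with
`ψᵀ S_w ψ > 0`, then the Fisher criterion `J(φ) = (φᵀ S_b φ)/(φᵀ S_w φ)` is unbounded above
on `{φ : φᵀ S_w φ > 0}`. -/
theorem stmt12 (d : ℕ) (Sw Sb : Matrix (Fin d) (Fin d) ℝ)
    (hSw : Sw.IsSymm) (hSb : Sb.IsSymm)
    (hSwPsd : ∀ v : Fin d → ℝ, 0 ≤ v ⬝ᵥ Sw.mulVec v)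
    (φ₀ : Fin d → ℝ) (hφ₀w : φ₀ ⬝ᵥ Sw.mulVec φ₀ = 0) (hφ₀b : 0 < φ₀ ⬝ᵥ Sb.mulVec φ₀)
    (ψ : Fin d → ℝ) (hψ : 0 < ψ ⬝ᵥ Sw.mulVec ψ) :
    ∀ M : ℝ, ∃ φ : Fin d → ℝ,
      0 < φ ⬝ᵥ Sw.mulVec φ ∧ M < (φ ⬝ᵥ Sb.mulVec φ) / (φ ⬝ᵥ Sw.mulVec φ) := by
  intro M
  have cross : φ₀ ⬝ᵥ Sw.mulVec ψ + ψ ⬝ᵥ Sw.mulVec φ₀ = 0 := by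
    set c := φ₀ ⬝ᵥ Sw.mulVec ψ + ψ ⬝ᵥ Sw.mulVec φ₀ with hc
    have h := discrim_le_zero (a := ψ ⬝ᵥ Sw.mulVec ψ) (b := c) (c := 0) fun t => by
      have ht := hSwPsd (φ₀ + t • ψ)
      rw [dotProduct_mulVec_add_smul, hφ₀w, ← hc] at ht
      linarith
    rw [discrim] at h
    nlinarith [sq_nonneg c]
  have within (t : ℝ) :
      (φ₀ + t • ψ) ⬝ᵥ Sw.mulVec (φ₀ + t • ψ) = t ^ 2 * (ψ ⬝ᵥ Sw.mulVec ψ) := by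
    rw [dotProduct_mulVec_add_smul, hφ₀w, cross]
    ring
  have hcont : Continuous fun t : ℝ =>
      (φ₀ + t • ψ) ⬝ᵥ Sb.mulVec (φ₀ + t • ψ) - M * (t ^ 2 * (ψ ⬝ᵥ Sw.mulVec ψ)) := by
    simp only [dotProduct_mulVec_add_smul]
    fun_prop
  have hnear := (hcont.tendsto 0).eventually_const_lt (u := 0) (by simpa using hφ₀b)
  obtain ⟨t, ht, ht0⟩ :=
    ((hnear.filter_mono nhdsWithin_le_nhds).and (self_mem_nhdsWithin (s := Set.Ioi 0))).exists
  have hpos : 0 < t ^ 2 * (ψ ⬝ᵥ Sw.mulVec ψ) := mul_pos (pow_pos ht0 2) hψ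
  refine ⟨φ₀ + t • ψ, ?_, ?_⟩
  · rwa [within]
  · rw [within, lt_div_iff₀ hpos]
    exact sub_pos.mp ht
end
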